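/- arXiv:1702.00672 — 9 statements merged into one kernel-verified Lean document; each statement's English description precedes it below -/
import Mathlib

section
/- Let 1/√2 < V ≤ 1. For every MUB pair on the qubit, the BB84 family box P_BB84^V admits no extremal LHV-LHS model. (Together with the converse, the BB84 family admits an extremal LHV-LHS model if and only if V ≤ 1/√2.) -/
open Matrix Complex BigOperators
open scoped ComplexOrder

noncomputable section

abbrev Vec : Type := Fin 2 → ℂ
abbrev Mat : Type := Matrix (Fin 2) (Fin 2) ℂ

/-- Inner product ⟨v, w⟩ on ℂ², conjugate-linear in the first argument. -/
def inn (v w : Vec) : ℂ := star v ⬝ᵥ w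

/-- A pair of mutually unbiased orthonormal bases of ℂ²: `e 0 = {f₀,f₁}` and `e 1 = {g₀,g₁}`. -/
def IsMUBPair (e : Fin 2 → Fin 2 → Vec) : Prop :=
  (∀ y i j, inn (e y i) (e y j) = if i = j then 1 else 0) ∧
  (∀ i j, Complex.normSq (inn (e 0 i) (e 1 j)) = 1 / 2)

/-- The BB84 family box `P_BB84^V(a,b|x,y) = (1 + (−1)^{a⊕b⊕x·y} δ_{x,y} V)/4`. -/
def PBB84 (V : ℝ) (a b x y : Fin 2) : ℝ :=
  (1 + (-1 : ℝ) ^ ((a + b + x * y : Fin 2) : ℕ) * (if x = y then V else 0)) / 4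

/-- A box admits an extremal LHV-LHS model: a convex mixture of products of Alice's
deterministic response functions with Bob's pure-state quantum distributions in the MUBs. -/
def HasExtremalLHVLHS (e : Fin 2 → Fin 2 → Vec)
    (P : Fin 2 → Fin 2 → Fin 2 → Fin 2 → ℝ) : Prop :=
  ∃ (n : ℕ) (p : Fin n → ℝ) (A : Fin 2 → Fin n → Fin 2) (ψ : Fin n → Vec),
    (∀ l, 0 ≤ p l) ∧ (∑ l, p l = 1) ∧
    (∀ l, inn (ψ l) (ψ l) = 1) ∧
    (∀ a b x y, P a b x y =
      ∑ l, p l * (if a = A x l then 1 else 0) * Complex.normSq (inn (e y b) (ψ l)))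

/-- Inner products are conjugate-symmetric. -/
lemma star_inn (v w : Vec) : star (inn v w) = inn w v := by
  simp [inn, dotProduct, Fin.sum_univ_two, mul_comm]

/-- Resolution of the identity in an orthonormal basis. -/
lemma inn_eq_add_of_orthonormal (f : Fin 2 → Vec)
    (hf : ∀ i j, inn (f i) (f j) = if i = j then 1 else 0) (v w : Vec) :
    inn v w = inn v (f 0) * inn (f 0) w + inn v (f 1) * inn (f 1) w := by
  let N : Mat := Matrix.of fun i k => star (f i k)
  have hN : N * Nᴴ = 1 := by
    ext i j
    have := hf i j
    simpa [N, inn, Matrix.mul_apply, dotProduct, Matrix.one_apply] using this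
  have hN' : Nᴴ * N = 1 := mul_eq_one_comm.mp hN
  have hc (k m : Fin 2) : f 0 k * star (f 0 m) + f 1 k * star (f 1 m)
      = if k = m then 1 else 0 := by
    have := congrFun (congrFun hN' k) m
    simpa [N, Matrix.mul_apply, Fin.sum_univ_two, Matrix.one_apply] using this
  have h00 := hc 0 0
  have h01 := hc 0 1
  have h10 := hc 1 0
  have h11 := hc 1 1
  simp only [Fin.isValue, if_true, zero_ne_one, one_ne_zero, if_false] at h00 h01 h10 h11
  simp only [inn, dotProduct, Fin.sum_univ_two, Pi.star_apply]
  linear_combination (-(star (v 0) * w 0)) * h00 - star (v 0) * w 1 * h01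
    - star (v 1) * w 0 * h10 - star (v 1) * w 1 * h11

/-- Parseval's identity for a unit vector. -/
lemma normSq_inn_add_normSq_inn (f : Fin 2 → Vec)
    (hf : ∀ i j, inn (f i) (f j) = if i = j then 1 else 0) (v : Vec) (hv : inn v v = 1) :
    normSq (inn (f 0) v) + normSq (inn (f 1) v) = 1 := by
  have h := inn_eq_add_of_orthonormal f hf v v
  rw [hv, ← star_inn (f 0) v, ← star_inn (f 1) v] at h
  have h' := congrArg Complex.re h
  simp [normSq_apply] at h' ⊢
  linarith

/-- The expectation value, in the state `v`, of the `±1`-valued measurement in the basis `f`. -/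
def bias (f : Fin 2 → Vec) (v : Vec) : ℝ := normSq (inn (f 0) v) - normSq (inn (f 1) v)

/-- The expectation values of two mutually unbiased measurements lie in the unit disc. -/
lemma bias_sq_add_bias_sq_le_one (e : Fin 2 → Fin 2 → Vec) (he : IsMUBPair e) (v : Vec)
    (hv : inn v v = 1) : bias (e 0) v ^ 2 + bias (e 1) v ^ 2 ≤ 1 := by
  obtain ⟨ho, hm⟩ := he
  have h0 := normSq_inn_add_normSq_inn (e 0) (ho 0) v hv
  have h1 := normSq_inn_add_normSq_inn (e 1) (ho 1) v hv
  have hg := inn_eq_add_of_orthonormal (e 0) (ho 0) (e 1 0) v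
  have hc (i : Fin 2) : normSq (inn (e 1 0) (e 0 i)) = 1 / 2 := by
    rw [← star_inn, ← hm i 0]
    exact normSq_conj _
  have hc0 := hc 0
  have hc1 := hc 1
  unfold bias
  generalize inn (e 1 0) (e 0 0) = c at *
  generalize inn (e 1 0) (e 0 1) = d at *
  generalize inn (e 0 0) v = a at *
  generalize inn (e 0 1) v = b at *
  have hs : normSq (inn (e 1 0) v)
      = 1 / 2 + 2 * (c * a * (starRingEnd ℂ) (d * b)).re := by
    rw [hg, normSq_add, normSq_mul, normSq_mul, hc0, hc1]
    linarith
  set z := c * a * (starRingEnd ℂ) (d * b) with hz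
  have hzn : normSq z = normSq a * normSq b / 4 := by
    rw [hz, normSq_mul, normSq_conj, normSq_mul, normSq_mul, hc0, hc1]
    ring
  have hzr : z.re ^ 2 ≤ normSq z := by
    rw [normSq_apply]
    nlinarith [mul_self_nonneg z.im]
  have hb : normSq (inn (e 1 0) v) - normSq (inn (e 1 1) v) = 4 * z.re := by linarith
  have hab : (normSq a + normSq b) ^ 2 = 1 := by rw [h0]; norm_num
  rw [hb]
  nlinarith

/-- The coordinates of a point of the unit disc sum to at most `√2`. -/
lemma add_le_sqrt_two_of_sq_add_sq_le_one {s t : ℝ} (h : s ^ 2 + t ^ 2 ≤ 1) : s + t ≤ √2 :=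
  Real.le_sqrt_of_sq_le (by nlinarith [sq_nonneg (s - t)])

/-- For `1/√2 < V ≤ 1`, the BB84 family admits no extremal LHV-LHS model,
for every MUB pair on the qubit. -/
theorem bb84_no_extremal_LHVLHS (V : ℝ) (hV1 : 1 / Real.sqrt 2 < V) (hV2 : V ≤ 1)
    (e : Fin 2 → Fin 2 → Vec) (he : IsMUBPair e) :
    ¬ HasExtremalLHVLHS e (PBB84 V) := by
  rintro ⟨n, p, A, ψ, hp, hsum, hψ, hP⟩
  let σ (a : Fin 2) : ℝ := if a = 0 then 1 else -1
  have hσ (a : Fin 2) : σ a ^ 2 = 1 := by fin_cases a <;> simp [σ]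
  have hcorr (x : Fin 2) : PBB84 V 0 0 x x - PBB84 V 0 1 x x - PBB84 V 1 0 x x + PBB84 V 1 1 x x
      = ∑ l, p l * (σ (A x l) * bias (e x) (ψ l)) := by
    simp only [hP, ← Finset.sum_sub_distrib, ← Finset.sum_add_distrib]
    refine Finset.sum_congr rfl fun l _ => ?_
    obtain h | h : A x l = 0 ∨ A x l = 1 := by omega
    all_goals simp [h, σ, bias]; ring
  have h0 := hcorr 0
  have h1 := hcorr 1
  have hV : 2 * V = ∑ l, p l * (σ (A 0 l) * bias (e 0) (ψ l) + -(σ (A 1 l) * bias (e 1) (ψ l))) := by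
    simp only [mul_add, mul_neg, Finset.sum_add_distrib, Finset.sum_neg_distrib, ← h0, ← h1]
    simp [PBB84]
    ring
  have hle : 2 * V ≤ √2 := by
    rw [hV, ← one_mul √2, ← hsum, Finset.sum_mul]
    refine Finset.sum_le_sum fun l _ => mul_le_mul_of_nonneg_left ?_ (hp l)
    apply add_le_sqrt_two_of_sq_add_sq_le_one
    rw [neg_sq, mul_pow, mul_pow, hσ, hσ, one_mul, one_mul]
    exact bias_sq_add_bias_sq_le_one e he (ψ l) (hψ l)
  have hdiv : 1 / √2 = √2 / 2 := by
    rw [div_eq_div_iff (by positivity) two_ne_zero, Real.mul_self_sqrt zero_le_two, one_mul]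
  linarith
end
end

section
/- Let 0 ≤ V ≤ 1/√2. For every MUB pair on the qubit, the BB84 family box P_BB84^V admits an extremal LHV-LHS model; moreover such a model exists with a hidden variable taking only 4 values, with Alice's four response functions being the four deterministic strategies a = αx ⊕ β (α,β ∈ {0,1}). -/
open Matrix Complex BigOperators
open scoped ComplexOrder

noncomputable section

lemma inn_add_smul (g v w : Vec) (a b : ℂ) :
    inn g (a • v + b • w) = a * inn g v + b * inn g w := by
  simp [inn, dotProduct_add, dotProduct_smul]

/-- Parseval's identity for an orthonormal basis of `ℂ²`. -/
lemma sum_normSq_inn_of_orthonormal {g : Fin 2 → Vec}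
    (hg : ∀ i j, inn (g i) (g j) = if i = j then 1 else 0) (ψ : Vec) :
    ((normSq (inn (g 0) ψ) + normSq (inn (g 1) ψ) : ℝ) : ℂ) = inn ψ ψ := by
  let U : Mat := fun i j => star (g i j)
  have hU : U * Uᴴ = 1 := by
    ext i j
    rw [Matrix.one_apply, ← hg i j, Matrix.mul_apply]
    simp only [conjTranspose_apply]
    simp [U, inn, dotProduct]
  have hU' : Uᴴ * U = 1 := mul_eq_one_comm.mp hU
  have hi : ∀ i, inn (g i) ψ = (U *ᵥ ψ) i := fun i => rfl
  calc ((normSq (inn (g 0) ψ) + normSq (inn (g 1) ψ) : ℝ) : ℂ)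
      = star (U *ᵥ ψ) ⬝ᵥ (U *ᵥ ψ) := by
        simp [hi, dotProduct, normSq_eq_conj_mul_self]
    _ = inn ψ ψ := by
        rw [star_mulVec, ← dotProduct_mulVec, mulVec_mulVec, hU', one_mulVec, inn]

/-- Any pair of biases `(s, t)` in the closed unit disc with `-1 < s` is attained by a pure
qubit state measured in a pair of mutually unbiased bases. -/
lemma exists_state_of_biases {e : Fin 2 → Fin 2 → Vec} (he : IsMUBPair e) {s t : ℝ}
    (hs : -1 < s) (hst : s ^ 2 + t ^ 2 ≤ 1) :
    ∃ ψ : Vec, inn ψ ψ = 1 ∧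
      normSq (inn (e 0 0) ψ) = (1 + s) / 2 ∧ normSq (inn (e 0 1) ψ) = (1 - s) / 2 ∧
      normSq (inn (e 1 0) ψ) = (1 + t) / 2 ∧ normSq (inn (e 1 1) ψ) = (1 - t) / 2 := by
  obtain ⟨ho, hm⟩ := he
  obtain ⟨u, hu0, hu⟩ : ∃ u : ℝ, 0 < u ∧ u * u = (1 + s) / 2 :=
    ⟨√((1 + s) / 2), Real.sqrt_pos.mpr (by linarith), Real.mul_self_sqrt (by linarith)⟩
  obtain ⟨r, hr⟩ : ∃ r : ℝ, r * r = (1 - s ^ 2 - t ^ 2) / 4 :=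
    ⟨√((1 - s ^ 2 - t ^ 2) / 4), Real.mul_self_sqrt (by linarith)⟩
  have hsymm : ∀ v w : Vec, normSq (inn v w) = normSq (inn w v) := by
    intro v w
    rw [← normSq_conj (inn w v)]
    congr 1
    simp [inn, dotProduct, mul_comm]
  set c := inn (e 1 0) (e 0 0) with hc
  set d := inn (e 1 0) (e 0 1) with hd
  have hc2 : normSq c = 1 / 2 := by rw [hc, hsymm, hm]
  have hd2 : normSq d = 1 / 2 := by rw [hd, hsymm, hm]
  let z : ℂ := ⟨t / 2, r⟩
  have hz : normSq z = (1 - s ^ 2) / 4 := by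
    simp only [normSq_mk, z, hr]; ring
  let q : ℂ := z * (2 * c * star d)
  let v : ℂ := q / (u : ℂ)
  let ψ : Vec := (u : ℂ) • e 0 0 + v • e 0 1
  have hv : normSq v = (1 - s) / 2 := by
    have h2 : normSq (2 : ℂ) = 4 := by norm_num [normSq_apply]
    have : normSq v = (1 - s ^ 2) / 4 / ((1 + s) / 2) := by
      simp only [v, q, map_div₀, map_mul, hz, hc2, h2, normSq_ofReal, hu, star_def, normSq_conj, hd2]
      ring
    rw [this]
    have : 1 + s ≠ 0 := by linarith
    field_simp
    ring
  have h00 : inn (e 0 0) ψ = u := by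
    rw [show inn (e 0 0) ψ = u * _ + v * _ from inn_add_smul _ _ _ _ _, ho, ho]
    simp
  have h01 : inn (e 0 1) ψ = v := by
    rw [show inn (e 0 1) ψ = u * _ + v * _ from inn_add_smul _ _ _ _ _, ho, ho]
    simp
  have hn00 : normSq (inn (e 0 0) ψ) = (1 + s) / 2 := by rw [h00, normSq_ofReal, hu]
  have hn01 : normSq (inn (e 0 1) ψ) = (1 - s) / 2 := by rw [h01, hv]
  have hψ : inn ψ ψ = 1 := by
    rw [← sum_normSq_inn_of_orthonormal (ho 0) ψ, hn00, hn01]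
    norm_num
    ring
  have hn10 : normSq (inn (e 1 0) ψ) = (1 + t) / 2 := by
    have hcross : ((u * c) * (starRingEnd ℂ) (v * d)).re = t / 4 := by
      have hune : (u : ℂ) ≠ 0 := by exact_mod_cast hu0.ne'
      have : (u * c) * (starRingEnd ℂ) (v * d)
          = ((2 * normSq c * normSq d : ℝ) : ℂ) * (starRingEnd ℂ) z := by
        simp only [v, q, map_div₀, map_mul, conj_ofReal, star_def, conj_conj, ofReal_mul,
          normSq_eq_conj_mul_self, map_ofNat, ofReal_ofNat]
        field_simp
      rw [this, hc2, hd2, re_ofReal_mul]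
      simp only [conj_re, z]
      ring
    rw [show inn (e 1 0) ψ = u * c + v * d from inn_add_smul _ _ _ _ _, normSq_add, hcross,
      map_mul, map_mul, normSq_ofReal, hu, hv, hc2, hd2]
    ring
  refine ⟨ψ, hψ, hn00, hn01, hn10, ?_⟩
  have hP := sum_normSq_inn_of_orthonormal (ho 1) ψ
  rw [hψ, hn10] at hP
  have hP' : (1 + t) / 2 + normSq (inn (e 1 1) ψ) = 1 := by exact_mod_cast hP
  linarith

/-- For `0 ≤ V ≤ 1/√2`, the BB84 family admits an extremal LHV-LHS model for every MUB
pair; moreover one exists with a 4-valued hidden variable `(α,β)` where Alice's response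
functions are the four deterministic strategies `a = α·x ⊕ β`. -/
theorem bb84_extremal_LHVLHS (V : ℝ) (hV0 : 0 ≤ V) (hV : V ≤ 1 / Real.sqrt 2)
    (e : Fin 2 → Fin 2 → Vec) (he : IsMUBPair e) :
    HasExtremalLHVLHS e (PBB84 V) ∧
    ∃ (p : Fin 2 → Fin 2 → ℝ) (ψ : Fin 2 → Fin 2 → Vec),
      (∀ α β, 0 ≤ p α β) ∧ (∑ α, ∑ β, p α β = 1) ∧
      (∀ α β, inn (ψ α β) (ψ α β) = 1) ∧
      (∀ a b x y, PBB84 V a b x y =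
        ∑ α, ∑ β, p α β * (if a = α * x + β then 1 else 0) *
          Complex.normSq (inn (e y b) (ψ α β))) := by
  have hV2 : V ^ 2 + V ^ 2 ≤ 1 := by
    have h := pow_le_pow_left₀ hV0 hV 2
    rw [div_pow, Real.sq_sqrt (by norm_num)] at h
    linarith
  have key : ∃ (p : Fin 2 → Fin 2 → ℝ) (ψ : Fin 2 → Fin 2 → Vec),
      (∀ α β, 0 ≤ p α β) ∧ (∑ α, ∑ β, p α β = 1) ∧
      (∀ α β, inn (ψ α β) (ψ α β) = 1) ∧
      (∀ a b x y, PBB84 V a b x y =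
        ∑ α, ∑ β, p α β * (if a = α * x + β then 1 else 0) *
          Complex.normSq (inn (e y b) (ψ α β))) := by
    have hV1 : V < 1 := by nlinarith
    obtain ⟨ψ₀₀, n₀₀, a₀₀, b₀₀, c₀₀, d₀₀⟩ :=
      exists_state_of_biases he (s := V) (t := -V) (by linarith) (by linarith [neg_sq V])
    obtain ⟨ψ₀₁, n₀₁, a₀₁, b₀₁, c₀₁, d₀₁⟩ :=
      exists_state_of_biases he (s := -V) (t := V) (by linarith) (by linarith [neg_sq V])
    obtain ⟨ψ₁₀, n₁₀, a₁₀, b₁₀, c₁₀, d₁₀⟩ :=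
      exists_state_of_biases he (s := V) (t := V) (by linarith) hV2
    obtain ⟨ψ₁₁, n₁₁, a₁₁, b₁₁, c₁₁, d₁₁⟩ :=
      exists_state_of_biases he (s := -V) (t := -V) (by linarith) (by linarith [neg_sq V])
    refine ⟨fun _ _ => 1 / 4, ![![ψ₀₀, ψ₀₁], ![ψ₁₀, ψ₁₁]], fun _ _ => by norm_num,
      by norm_num, ?_, ?_⟩
    · simp [Fin.forall_fin_two, n₀₀, n₀₁, n₁₀, n₁₁]
    · simp only [Fin.forall_fin_two, Fin.sum_univ_two]
      simp [PBB84, a₀₀, b₀₀, c₀₀, d₀₀, a₀₁, b₀₁, c₀₁, d₀₁, a₁₀, b₁₀, c₁₀, d₁₀,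
        a₁₁, b₁₁, c₁₁, d₁₁]
      ring_nf
      simp
  refine ⟨?_, key⟩
  obtain ⟨p, ψ, hp, hsum, hψ, hP⟩ := key
  refine ⟨2 * 2, fun l => p (finProdFinEquiv.symm l).1 (finProdFinEquiv.symm l).2,
    fun x l => (finProdFinEquiv.symm l).1 * x + (finProdFinEquiv.symm l).2,
    fun l => ψ (finProdFinEquiv.symm l).1 (finProdFinEquiv.symm l).2,
    fun _ => hp _ _, ?_, fun _ => hψ _ _, fun a b x y => ?_⟩
  · rw [finProdFinEquiv.symm.sum_comp (fun l => p l.1 l.2), Fintype.sum_prod_type, hsum]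
  · rw [hP, finProdFinEquiv.symm.sum_comp (fun l => p l.1 l.2 *
      (if a = l.1 * x + l.2 then 1 else 0) * normSq (inn (e y b) (ψ l.1 l.2))),
      Fintype.sum_prod_type]
end
end

section
/- For every MUB pair on the qubit and every 0 ≤ V ≤ 1, the steering cost of the BB84 family box equals C(P_BB84^V) = max{0, (√2·V − 1)/(√2 − 1)}. -/
open Matrix Complex BigOperators
open scoped ComplexOrder

noncomputable section

/-- A box is unsteerable: it admits a LHV-LHS model. -/
def Unsteerable (e : Fin 2 → Fin 2 → Vec)
    (P : Fin 2 → Fin 2 → Fin 2 → Fin 2 → ℝ) : Prop :=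
  ∃ (n : ℕ) (p : Fin n → ℝ) (q : Fin 2 → Fin 2 → Fin n → ℝ) (ρ : Fin n → Mat),
    (∀ l, 0 ≤ p l) ∧ (∑ l, p l = 1) ∧
    (∀ a x l, 0 ≤ q a x l) ∧ (∀ x l, ∑ a, q a x l = 1) ∧
    (∀ l, (ρ l).PosSemidef) ∧ (∀ l, (ρ l).trace = 1) ∧
    (∀ a b x y, P a b x y =
      ∑ l, p l * q a x l * (star (e y b) ⬝ᵥ (ρ l).mulVec (e y b)).re)

/-- An assemblage: PSD matrices σ_{a|x} with a common unit-trace reduced state. -/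
def IsAssemblage (σ : Fin 2 → Fin 2 → Mat) : Prop :=
  (∀ a x, (σ a x).PosSemidef) ∧ (∑ a, σ a 0) = (∑ a, σ a 1) ∧ (∑ a, σ a 0).trace = 1

/-- The box produced by an assemblage and Bob's projective measurements in the MUBs. -/
def boxOf (e : Fin 2 → Fin 2 → Vec) (σ : Fin 2 → Fin 2 → Mat)
    (a b x y : Fin 2) : ℝ :=
  (star (e y b) ⬝ᵥ (σ a x).mulVec (e y b)).re

/-- A box is quantum-realizable. -/
def QuantumBox (e : Fin 2 → Fin 2 → Vec)
    (P : Fin 2 → Fin 2 → Fin 2 → Fin 2 → ℝ) : Prop :=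
  ∃ σ : Fin 2 → Fin 2 → Mat, IsAssemblage σ ∧ ∀ a b x y, P a b x y = boxOf e σ a b x y

/-- The steering cost of a box: the infimum of the steerable weight over all
decompositions into a quantum-realizable box and an unsteerable box. -/
def steeringCost (e : Fin 2 → Fin 2 → Vec)
    (P : Fin 2 → Fin 2 → Fin 2 → Fin 2 → ℝ) : ℝ :=
  sInf {p : ℝ | p ∈ Set.Icc (0 : ℝ) 1 ∧
    ∃ PS PUS : Fin 2 → Fin 2 → Fin 2 → Fin 2 → ℝ,
      QuantumBox e PS ∧ Unsteerable e PUS ∧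
      ∀ a b x y, P a b x y = p * PS a b x y + (1 - p) * PUS a b x y}

/-- The rank-one matrix `|v⟩⟨v|`. -/
def proj (v : Vec) : Mat := vecMulVec v (star v)

/-- The ±1-valued observable of the `y`-th basis. -/
def obs (e : Fin 2 → Fin 2 → Vec) (y : Fin 2) : Mat := proj (e y 0) - proj (e y 1)

/-- The expectation of the `y`-th observable in a (possibly subnormalized) state. -/
def expec (e : Fin 2 → Fin 2 → Vec) (σ : Mat) (y : Fin 2) : ℝ := (σ * obs e y).trace.re

/-- The state with Bloch coordinates `u`, `v` along the two observables. -/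
def bloch (e : Fin 2 → Fin 2 → Vec) (u v : ℝ) : Mat :=
  (1 / 2 : ℂ) • (1 + (u : ℂ) • obs e 0 + (v : ℂ) • obs e 1)

lemma proj_isHermitian (v : Vec) : (proj v).IsHermitian := by
  simp [proj, Matrix.IsHermitian, Matrix.conjTranspose_vecMulVec]

lemma obs_isHermitian (e : Fin 2 → Fin 2 → Vec) (y : Fin 2) : (obs e y).IsHermitian :=
  (proj_isHermitian _).sub (proj_isHermitian _)

lemma proj_mul_proj (v w : Vec) : proj v * proj w = inn v w • vecMulVec v (star w) := by
  simp [proj, inn, Matrix.vecMulVec_mul_vecMulVec, Matrix.vecMulVec_smul]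

lemma proj_mul_proj_mul_proj (v w : Vec) :
    proj v * proj w * proj v = (Complex.normSq (inn v w) : ℂ) • proj v := by
  have h : star w ⬝ᵥ v = star (star v ⬝ᵥ w) := by
    rw [Matrix.star_dotProduct]
  rw [proj_mul_proj, proj, Matrix.smul_mul, Matrix.vecMulVec_mul_vecMulVec, h,
    Matrix.vecMulVec_smul, smul_smul, Complex.normSq_eq_conj_mul_self, mul_comm]
  rfl

lemma quadForm_eq_trace (M : Mat) (v : Vec) : star v ⬝ᵥ M *ᵥ v = (M * proj v).trace := by
  rw [proj, Matrix.mul_vecMulVec, Matrix.trace_vecMulVec, dotProduct_comm]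

section MUB

variable {e : Fin 2 → Fin 2 → Vec}

lemma IsMUBPair.proj_add_proj (he : IsMUBPair e) (y : Fin 2) :
    proj (e y 0) + proj (e y 1) = 1 := by
  let U : Mat := Matrix.of fun b i => star (e y b i)
  have hU : U * Uᴴ = 1 := by
    ext i j
    have h := he.1 y i j
    simpa [U, inn, Matrix.mul_apply, Matrix.one_apply, dotProduct] using h
  rw [← mul_eq_one_comm.mp hU]
  ext i j
  simp [U, proj, Matrix.mul_apply, Matrix.vecMulVec_apply]

lemma IsMUBPair.proj_mul_self (he : IsMUBPair e) (y i : Fin 2) :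
    proj (e y i) * proj (e y i) = proj (e y i) := by
  rw [proj_mul_proj, he.1 y i i, if_pos rfl, one_smul, proj]

lemma IsMUBPair.proj_mul_proj_of_ne (he : IsMUBPair e) (y : Fin 2) {i j : Fin 2} (h : i ≠ j) :
    proj (e y i) * proj (e y j) = 0 := by
  rw [proj_mul_proj, he.1 y i j, if_neg h, zero_smul]

lemma IsMUBPair.obs_mul_self (he : IsMUBPair e) (y : Fin 2) : obs e y * obs e y = 1 := by
  simp only [obs, sub_mul, mul_sub, he.proj_mul_self, he.proj_mul_proj_of_ne y zero_ne_one,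
    he.proj_mul_proj_of_ne y one_ne_zero]
  rw [← he.proj_add_proj y]
  abel

lemma IsMUBPair.proj_mul_obs_mul_proj (he : IsMUBPair e) (i : Fin 2) :
    proj (e 0 i) * obs e 1 * proj (e 0 i) = 0 := by
  rw [obs, mul_sub, sub_mul, proj_mul_proj_mul_proj, proj_mul_proj_mul_proj, he.2, he.2, sub_self]

lemma IsMUBPair.obs_anticomm (he : IsMUBPair e) : obs e 0 * obs e 1 = -(obs e 1 * obs e 0) := by
  have h : obs e 0 * obs e 1 * (proj (e 0 0) + proj (e 0 1))
      + (proj (e 0 0) + proj (e 0 1)) * obs e 1 * obs e 0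
      = (2 : ℕ) • (proj (e 0 0) * obs e 1 * proj (e 0 0))
        - (2 : ℕ) • (proj (e 0 1) * obs e 1 * proj (e 0 1)) := by
    rw [obs]
    noncomm_ring
  rw [he.proj_add_proj, he.proj_mul_obs_mul_proj, he.proj_mul_obs_mul_proj, mul_one, one_mul,
    sub_self] at h
  exact eq_neg_of_add_eq_zero_left h

lemma IsMUBPair.trace_obs (he : IsMUBPair e) (y : Fin 2) : (obs e y).trace = 0 := by
  have h (b : Fin 2) : (proj (e y b)).trace = 1 := by
    have := he.1 y b b
    rw [if_pos rfl, inn, dotProduct_comm] at this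
    rw [proj, Matrix.trace_vecMulVec, this]
  rw [obs, Matrix.trace_sub, h, h, sub_self]

lemma IsMUBPair.trace_obs_mul_obs (he : IsMUBPair e) : (obs e 0 * obs e 1).trace = 0 := by
  have h := congrArg Matrix.trace he.obs_anticomm
  rw [Matrix.trace_neg, Matrix.trace_mul_comm (obs e 1)] at h
  exact self_eq_neg.mp h

lemma IsMUBPair.quadForm_eq (he : IsMUBPair e) (M : Mat) (y b : Fin 2) :
    (star (e y b) ⬝ᵥ M *ᵥ e y b).re = (M.trace.re + (-1) ^ (b : ℕ) * expec e M y) / 2 := by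
  have h : M.trace = (M * proj (e y 0)).trace + (M * proj (e y 1)).trace := by
    rw [← Matrix.trace_add, ← mul_add, he.proj_add_proj, mul_one]
  rw [quadForm_eq_trace, h, expec, obs, mul_sub, Matrix.trace_sub, add_re, sub_re]
  fin_cases b
  · simp
  · simp
    ring

lemma IsMUBPair.trace_bloch (he : IsMUBPair e) (u v : ℝ) : (bloch e u v).trace = 1 := by
  simp [bloch, he.trace_obs]

lemma IsMUBPair.expec_bloch_zero (he : IsMUBPair e) (u v : ℝ) : expec e (bloch e u v) 0 = u := by
  have h : (obs e 1 * obs e 0).trace = 0 := by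
    rw [Matrix.trace_mul_comm, he.trace_obs_mul_obs]
  simp [expec, bloch, add_mul, he.trace_obs, he.obs_mul_self, h]
  ring

lemma IsMUBPair.expec_bloch_one (he : IsMUBPair e) (u v : ℝ) : expec e (bloch e u v) 1 = v := by
  simp [expec, bloch, add_mul, he.trace_obs, he.obs_mul_self, he.trace_obs_mul_obs]
  ring

lemma bloch_isHermitian (e : Fin 2 → Fin 2 → Vec) (u v : ℝ) : (bloch e u v).IsHermitian := by
  simp [bloch, Matrix.IsHermitian, Matrix.conjTranspose_smul, (obs_isHermitian e _).eq]

lemma IsMUBPair.bloch_mul_self (he : IsMUBPair e) {u v : ℝ} (h : u ^ 2 + v ^ 2 = 1) :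
    bloch e u v * bloch e u v = bloch e u v := by
  have h' : (u : ℂ) * u + v * v = 1 := by
    rw [← sq, ← sq]; exact_mod_cast h
  have h1 : ((u : ℂ) • obs e 0 + (v : ℂ) • obs e 1) * ((u : ℂ) • obs e 0 + (v : ℂ) • obs e 1)
      = ((u : ℂ) * u + v * v) • 1 := by
    simp only [add_mul, mul_add, Matrix.smul_mul, Matrix.mul_smul, smul_smul, he.obs_mul_self,
      he.obs_anticomm]
    module
  rw [h', one_smul] at h1
  rw [bloch, add_assoc]
  generalize (u : ℂ) • obs e 0 + (v : ℂ) • obs e 1 = H at *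
  simp only [add_mul, mul_add, Matrix.smul_mul, Matrix.mul_smul, h1, one_mul, mul_one]
  module

lemma IsMUBPair.bloch_posSemidef (he : IsMUBPair e) {u v : ℝ} (h : u ^ 2 + v ^ 2 = 1) :
    (bloch e u v).PosSemidef := by
  have := Matrix.posSemidef_conjTranspose_mul_self (bloch e u v)
  rwa [(bloch_isHermitian e u v).eq, he.bloch_mul_self h] at this

lemma IsMUBPair.expec_ineq (he : IsMUBPair e) {ρ : Mat} (hρ : ρ.PosSemidef) (ht : ρ.trace = 1)
    {u v : ℝ} (h : u ^ 2 + v ^ 2 = 1) : u * expec e ρ 0 + v * expec e ρ 1 ≤ 1 := by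
  have h' : (-u) ^ 2 + (-v) ^ 2 = 1 := by simpa using h
  have hpos := (hρ.conjTranspose_mul_mul_same (bloch e (-u) (-v))).trace_nonneg
  rw [(bloch_isHermitian e _ _).eq, Matrix.trace_mul_comm, ← mul_assoc, he.bloch_mul_self h',
    Matrix.trace_mul_comm] at hpos
  have := (Complex.le_def.mp hpos).1
  simp [bloch, mul_add, ht] at this
  simp only [expec]
  linarith

lemma IsMUBPair.correlation_le (he : IsMUBPair e) {ρ : Mat} (hρ : ρ.PosSemidef)
    (ht : ρ.trace = 1) {α β : ℝ} (hα : |α| ≤ 1) (hβ : |β| ≤ 1) :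
    α * expec e ρ 0 - β * expec e ρ 1 ≤ √2 := by
  have h2 : √2 ^ 2 = 2 := Real.sq_sqrt zero_le_two
  have key (s t : ℝ) (hs : s ^ 2 = 1) (ht' : t ^ 2 = 1) :
      s * expec e ρ 0 + t * expec e ρ 1 ≤ √2 := by
    have := he.expec_ineq hρ ht (u := s * √2 / 2) (v := t * √2 / 2) (by
      rw [div_pow, div_pow, mul_pow, mul_pow, hs, ht', h2]; norm_num)
    nlinarith [Real.sqrt_nonneg 2]
  have hx : α * expec e ρ 0 ≤ |expec e ρ 0| := by
    calc _ ≤ |α * expec e ρ 0| := le_abs_self _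
      _ = |α| * |expec e ρ 0| := abs_mul _ _
      _ ≤ _ := mul_le_of_le_one_left (abs_nonneg _) hα
  have hy : -(β * expec e ρ 1) ≤ |expec e ρ 1| := by
    calc _ ≤ |β * expec e ρ 1| := neg_le_abs _
      _ = |β| * |expec e ρ 1| := abs_mul _ _
      _ ≤ _ := mul_le_of_le_one_left (abs_nonneg _) hβ
  have h₁ := key 1 1 (by norm_num) (by norm_num)
  have h₂ := key 1 (-1) (by norm_num) (by norm_num)
  have h₃ := key (-1) 1 (by norm_num) (by norm_num)
  have h₄ := key (-1) (-1) (by norm_num) (by norm_num)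
  rcases abs_cases (expec e ρ 0) with ⟨h, _⟩ | ⟨h, _⟩ <;>
    rcases abs_cases (expec e ρ 1) with ⟨h', _⟩ | ⟨h', _⟩ <;> rw [h] at hx <;> rw [h'] at hy <;>
    linarith

end MUB

/-- The correlator `⟨A_x B_y⟩` of a box. -/
def correlator (P : Fin 2 → Fin 2 → Fin 2 → Fin 2 → ℝ) (x y : Fin 2) : ℝ :=
  P 0 0 x y - P 0 1 x y - P 1 0 x y + P 1 1 x y

/-- The value of the linear steering functional `⟨A₀ B₀⟩ - ⟨A₁ B₁⟩`. -/
def steeringValue (P : Fin 2 → Fin 2 → Fin 2 → Fin 2 → ℝ) : ℝ :=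
  correlator P 0 0 - correlator P 1 1

lemma PBB84_eq (V : ℝ) (a b x y : Fin 2) :
    PBB84 V a b x y = (1 + (-1) ^ (a : ℕ) * (-1) ^ (b : ℕ) *
      (if x = y then if x = 0 then V else -V else 0)) / 4 := by
  have h11 : (1 + 1 : Fin 2) = 0 := rfl
  fin_cases a <;> fin_cases b <;> fin_cases x <;> fin_cases y <;> simp [PBB84, h11]

lemma steeringValue_PBB84 (V : ℝ) : steeringValue (PBB84 V) = 2 * V := by
  simp [steeringValue, correlator, PBB84_eq]
  ring

lemma PBB84_affine (p V W : ℝ) (a b x y : Fin 2) :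
    PBB84 (p * V + (1 - p) * W) a b x y = p * PBB84 V a b x y + (1 - p) * PBB84 W a b x y := by
  simp only [PBB84]
  split_ifs <;> ring

section MUB

variable {e : Fin 2 → Fin 2 → Vec} {P : Fin 2 → Fin 2 → Fin 2 → Fin 2 → ℝ}

lemma QuantumBox.steeringValue_le (he : IsMUBPair e) (h : QuantumBox e P) :
    steeringValue P ≤ 2 := by
  obtain ⟨σ, ⟨hpos, hsum, htr⟩, hP⟩ := h
  have hnn (a b x y) : 0 ≤ P a b x y := by
    rw [hP]
    exact (Complex.le_def.mp ((hpos a x).dotProduct_mulVec_nonneg (e y b))).1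
  have hnorm (x y) : P 0 0 x y + P 0 1 x y + P 1 0 x y + P 1 1 x y = 1 := by
    have htx : (∑ a, σ a x).trace = 1 := by
      fin_cases x
      · exact htr
      · exact hsum ▸ htr
    have := congrArg Complex.re htx
    simp only [Fin.sum_univ_two, Matrix.trace_add, add_re, one_re] at this
    simp only [hP, boxOf, he.quadForm_eq]
    simp
    linarith
  simp only [steeringValue, correlator]
  linarith [hnorm 0 0, hnorm 1 1, hnn 0 1 0 0, hnn 1 0 0 0, hnn 0 0 1 1, hnn 1 1 1 1]

lemma Unsteerable.steeringValue_le (he : IsMUBPair e) (h : Unsteerable e P) :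
    steeringValue P ≤ √2 := by
  obtain ⟨n, p, q, ρ, hp, hp1, hq, hq1, hρ, hρ1, hP⟩ := h
  have hval : steeringValue P = ∑ l, p l *
      ((q 0 0 l - q 1 0 l) * expec e (ρ l) 0 - (q 0 1 l - q 1 1 l) * expec e (ρ l) 1) := by
    simp only [steeringValue, correlator, hP, he.quadForm_eq, ← Finset.sum_sub_distrib,
      ← Finset.sum_add_distrib]
    refine Finset.sum_congr rfl fun l _ => ?_
    simp
    ring
  have hα (x l) : |q 0 x l - q 1 x l| ≤ 1 := by
    have := hq1 x l
    rw [Fin.sum_univ_two] at this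
    rw [abs_le]
    constructor <;> linarith [hq 0 x l, hq 1 x l]
  calc steeringValue P ≤ ∑ l, p l * √2 := by
        rw [hval]
        exact Finset.sum_le_sum fun l _ => mul_le_mul_of_nonneg_left
          (he.correlation_le (hρ l) (hρ1 l) (hα 0 l) (hα 1 l)) (hp l)
    _ = √2 := by rw [← Finset.sum_mul, hp1, one_mul]

lemma IsMUBPair.quantumBox_PBB84_one (he : IsMUBPair e) : QuantumBox e (PBB84 1) := by
  refine ⟨fun a x => (1 / 2 : ℂ) • bloch e (if x = 0 then (-1) ^ (a : ℕ) else 0)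
    (if x = 0 then 0 else -(-1) ^ (a : ℕ)), ⟨fun a x => ?_, ?_, ?_⟩, fun a b x y => ?_⟩
  · refine Matrix.PosSemidef.smul (he.bloch_posSemidef ?_) (by positivity)
    fin_cases a <;> fin_cases x <;> simp
  · simp [Fin.sum_univ_two, bloch]
    module
  · simp [Fin.sum_univ_two, Matrix.trace_add, he.trace_bloch]
    norm_num
  · have hexp (c : ℂ) (M : Mat) (y) (hc : c.im = 0) : expec e (c • M) y = c.re * expec e M y := by
      simp [expec, hc]
    rw [boxOf, he.quadForm_eq, hexp _ _ _ (by simp), Matrix.trace_smul, he.trace_bloch]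
    fin_cases y
    · rw [Fin.zero_eta, he.expec_bloch_zero]
      fin_cases x <;> simp [PBB84_eq] <;> ring
    · rw [Fin.mk_one, he.expec_bloch_one]
      fin_cases x <;> simp [PBB84_eq] <;> ring

lemma IsMUBPair.unsteerable_PBB84 (he : IsMUBPair e) {V : ℝ} (h0 : 0 ≤ V) (h1 : √2 * V ≤ 1) :
    Unsteerable e (PBB84 V) := by
  have h2 : √2 * √2 = 2 := Real.mul_self_sqrt zero_le_two
  have hV : 0 ≤ √2 * V := by positivity
  let s : Fin 4 → ℝ := ![1, 1, -1, -1]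
  let t : Fin 4 → ℝ := ![1, -1, 1, -1]
  refine ⟨4, fun _ => 1 / 4,
    fun a x l => (1 + (-1) ^ (a : ℕ) * (√2 * V) * (if x = 0 then s l else -t l)) / 2,
    fun l => bloch e (s l * (√2 / 2)) (t l * (√2 / 2)), fun _ => by norm_num, by norm_num,
    fun a x l => ?_, fun x l => ?_, fun l => he.bloch_posSemidef ?_, fun l => he.trace_bloch _ _,
    fun a b x y => ?_⟩
  · fin_cases a <;> fin_cases x <;> fin_cases l <;> simp [s, t] <;> linarith
  · rw [Fin.sum_univ_two]
    simp only [Fin.val_zero, Fin.val_one, pow_zero, pow_one]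
    ring
  · have hs : s l ^ 2 = 1 ∧ t l ^ 2 = 1 := by fin_cases l <;> simp [s, t]
    rw [mul_pow, mul_pow, hs.1, hs.2]
    linarith
  · simp only [he.quadForm_eq, he.trace_bloch, Fin.sum_univ_four]
    generalize hα : (-1 : ℝ) ^ (a : ℕ) = α
    generalize hβ : (-1 : ℝ) ^ (b : ℕ) = β
    fin_cases y
    · simp only [Fin.zero_eta, he.expec_bloch_zero]
      fin_cases x <;> simp [PBB84_eq, s, t, hα, hβ]
      · linear_combination -(α * β * V / 8) * h2
      · ring
    · simp only [Fin.mk_one, he.expec_bloch_one]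
      fin_cases x <;> simp [PBB84_eq, s, t, hα, hβ]
      · ring
      · linear_combination (α * β * V / 8) * h2

end MUB

/-- The steering cost of the BB84 family: `C(P_BB84^V) = max{0, (√2·V − 1)/(√2 − 1)}`. -/
theorem bb84_steering_cost (e : Fin 2 → Fin 2 → Vec) (he : IsMUBPair e)
    (V : ℝ) (h0 : 0 ≤ V) (h1 : V ≤ 1) :
    steeringCost e (PBB84 V) = max 0 ((Real.sqrt 2 * V - 1) / (Real.sqrt 2 - 1)) := by
  have h2 : √2 * √2 = 2 := Real.mul_self_sqrt zero_le_two
  have hs : 1 < √2 := Real.one_lt_sqrt_two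
  have hd : 0 < √2 - 1 := sub_pos.mpr hs
  refine IsLeast.csInf_eq ⟨⟨⟨le_max_left _ _, max_le zero_le_one ?_⟩, ?_⟩, ?_⟩
  · rw [div_le_one hd]
    nlinarith
  · rcases le_total (√2 * V) 1 with h | h
    · have hp : max 0 ((√2 * V - 1) / (√2 - 1)) = 0 :=
        max_eq_left (div_nonpos_of_nonpos_of_nonneg (by linarith) hd.le)
      exact ⟨PBB84 1, PBB84 V, he.quantumBox_PBB84_one, he.unsteerable_PBB84 h0 h, by simp [hp]⟩
    · rw [max_eq_right (div_nonneg (by linarith) hd.le)]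
      refine ⟨PBB84 1, PBB84 (√2 / 2), he.quantumBox_PBB84_one,
        he.unsteerable_PBB84 (by positivity) (by linarith), fun a b x y => ?_⟩
      rw [← PBB84_affine]
      congr 1
      field_simp
      linear_combination (V - 1) * h2
  · rintro p ⟨⟨hp0, hp1⟩, PS, PUS, hS, hUS, hP⟩
    refine max_le hp0 ?_
    have hval : 2 * V = p * steeringValue PS + (1 - p) * steeringValue PUS := by
      rw [← steeringValue_PBB84]
      simp only [steeringValue, correlator, hP]
      ring
    have hle : 2 * V ≤ p * 2 + (1 - p) * √2 := by
      rw [hval]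
      exact add_le_add (mul_le_mul_of_nonneg_left (hS.steeringValue_le he) hp0)
        (mul_le_mul_of_nonneg_left (hUS.steeringValue_le he) (sub_nonneg.mpr hp1))
    rw [div_le_iff₀ hd]
    nlinarith
end
end

section
/- For every MUB pair on the qubit and every 0 ≤ V ≤ 1, the steering cost of the colored-noise BB84 family box equals C(P_col^V) = V. -/
open Matrix Complex BigOperators
open scoped ComplexOrder

noncomputable section

/-- The colored-noise BB84 family box. -/
def Pcol (V : ℝ) (a b x y : Fin 2) : ℝ :=
  (1 + (-1 : ℝ) ^ ((a + b + x * y : Fin 2) : ℕ) *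
        ((if x = y then V else 0) + (1 - V) / 2)
     + (-1 : ℝ) ^ ((a + b + x + y : Fin 2) : ℕ) * ((1 - V) / 2)) / 4

lemma fin_two_one_add_one : (1 + 1 : Fin 2) = 0 := rfl

lemma sum_vecMulVec_star_eq_one {v : Fin 2 → Vec}
    (hv : ∀ i j, inn (v i) (v j) = if i = j then 1 else 0) :
    ∑ i, vecMulVec (v i) (star (v i)) = (1 : Mat) := by
  have hU : (Matrix.of fun i k => star (v i k)) * (Matrix.of fun k j => v j k) = (1 : Mat) := by
    ext i j
    simpa [Matrix.mul_apply, Matrix.one_apply, inn, dotProduct] using hv i j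
  rw [mul_eq_one_comm] at hU
  rw [← hU]
  ext k l
  simp [Matrix.mul_apply, vecMulVec_apply]

lemma sum_inn_smul {v : Fin 2 → Vec}
    (hv : ∀ i j, inn (v i) (v j) = if i = j then 1 else 0) (w : Vec) :
    w = ∑ i, inn (v i) w • v i := by
  have h := congrArg (fun M : Mat => M *ᵥ w) (sum_vecMulVec_star_eq_one hv)
  simp only [Matrix.sum_mulVec, Matrix.one_mulVec] at h
  nth_rewrite 1 [← h]
  refine Finset.sum_congr rfl fun i _ => ?_
  rw [Matrix.vecMulVec_mulVec]
  ext k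
  simp [inn, mul_comm]

lemma sum_expectation_eq_trace {v : Fin 2 → Vec}
    (hv : ∀ i j, inn (v i) (v j) = if i = j then 1 else 0) (M : Mat) :
    ∑ i, star (v i) ⬝ᵥ M *ᵥ v i = M.trace := by
  have h := congrArg (fun N : Mat => (M * N).trace) (sum_vecMulVec_star_eq_one hv)
  simp only [mul_one, Finset.mul_sum, Matrix.trace_sum, Matrix.mul_vecMulVec,
    Matrix.trace_vecMulVec] at h
  rw [← h]
  exact Finset.sum_congr rfl fun i _ => dotProduct_comm _ _

lemma expectation_vecMulVec (v w : Vec) :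
    (star w ⬝ᵥ (vecMulVec v (star v)) *ᵥ w).re = Complex.normSq (inn v w) := by
  simp [inn, vecMulVec, Matrix.mulVec, dotProduct, Fin.sum_univ_two, Complex.normSq_apply]
  ring

lemma trace_vecMulVec_star (v : Vec) : (vecMulVec v (star v)).trace = inn v v := by
  rw [Matrix.trace_vecMulVec, dotProduct_comm, inn]

lemma IsMUBPair.normSq_inn {e : Fin 2 → Fin 2 → Vec} (he : IsMUBPair e) (y z i j : Fin 2) :
    Complex.normSq (inn (e y i) (e z j)) =
      if y = z then (if i = j then 1 else 0) else 1 / 2 := by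
  have hsymm : Complex.normSq (inn (e y i) (e z j)) = Complex.normSq (inn (e z j) (e y i)) := by
    rw [← Complex.normSq_conj (inn (e z j) (e y i))]
    simp [inn, dotProduct, mul_comm]
  by_cases hyz : y = z
  · subst hyz
    rw [he.1, if_pos rfl]
    split_ifs <;> simp
  · rw [if_neg hyz]
    fin_cases y <;> fin_cases z
    · exact absurd rfl hyz
    · exact he.2 i j
    · rw [hsymm]; exact he.2 j i
    · exact absurd rfl hyz

/-- The noiseless BB84 box is produced by the assemblage of half-weighted MUB projectors. -/
lemma quantumBox_Pcol_one {e : Fin 2 → Fin 2 → Vec} (he : IsMUBPair e) :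
    QuantumBox e (Pcol 1) := by
  refine ⟨fun a x => (1 / 2 : ℝ) • vecMulVec (e x (a + x)) (star (e x (a + x))),
    ⟨fun a x => (Matrix.posSemidef_vecMulVec_self_star _).smul (by norm_num), ?_, ?_⟩, ?_⟩
  · have h0 := sum_vecMulVec_star_eq_one (he.1 0)
    have h1 := sum_vecMulVec_star_eq_one (he.1 1)
    rw [Fin.sum_univ_two] at h0 h1
    simp only [Fin.sum_univ_two, ← smul_add]
    simp only [Fin.isValue, add_zero, zero_add, Fin.reduceAdd]
    rw [h0, add_comm, h1]
  · simp only [Fin.sum_univ_two, Matrix.trace_add, Matrix.trace_smul, trace_vecMulVec_star, he.1]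
    norm_num
  · intro a b x y
    simp only [boxOf, Matrix.smul_mulVec, dotProduct_smul, Complex.smul_re,
      expectation_vecMulVec, he.normSq_inn]
    fin_cases a <;> fin_cases b <;> fin_cases x <;> fin_cases y <;> norm_num [Pcol, fin_two_one_add_one]

/-- The fully noisy box is classical: Bob's state is a random element of the first basis. -/
lemma unsteerable_Pcol_zero {e : Fin 2 → Fin 2 → Vec} (he : IsMUBPair e) :
    Unsteerable e (Pcol 0) := by
  refine ⟨2, fun _ => 1 / 2, fun a x l => if x = 0 then (if a = l then 1 else 0) else 1 / 2,
    fun l => vecMulVec (e 0 l) (star (e 0 l)), by norm_num, by norm_num, ?_, ?_,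
    fun l => Matrix.posSemidef_vecMulVec_self_star _, ?_, ?_⟩
  · intro a x l
    dsimp only
    split_ifs <;> norm_num
  · intro x l
    fin_cases x <;> fin_cases l <;> norm_num [Fin.sum_univ_two]
  · intro l
    rw [trace_vecMulVec_star, he.1, if_pos rfl]
  · intro a b x y
    simp only [expectation_vecMulVec, he.normSq_inn, Fin.sum_univ_two]
    fin_cases a <;> fin_cases b <;> fin_cases x <;> fin_cases y <;> norm_num [Pcol, fin_two_one_add_one]

lemma Pcol_eq_mix (V : ℝ) (a b x y : Fin 2) :
    Pcol V a b x y = V * Pcol 1 a b x y + (1 - V) * Pcol 0 a b x y := by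
  simp only [Pcol]
  split_ifs <;> ring

lemma QuantumBox.nonneg {e : Fin 2 → Fin 2 → Vec} {P : Fin 2 → Fin 2 → Fin 2 → Fin 2 → ℝ}
    (hP : QuantumBox e P) (a b x y : Fin 2) : 0 ≤ P a b x y := by
  obtain ⟨σ, ⟨hσ, -⟩, h⟩ := hP
  rw [h]
  exact (hσ a x).re_dotProduct_nonneg (e y b)

lemma QuantumBox.sum_eq_one {e : Fin 2 → Fin 2 → Vec} (he : IsMUBPair e)
    {P : Fin 2 → Fin 2 → Fin 2 → Fin 2 → ℝ} (hP : QuantumBox e P) (x y : Fin 2) :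
    ∑ a, ∑ b, P a b x y = 1 := by
  obtain ⟨σ, ⟨-, hσ, htr⟩, h⟩ := hP
  have hx : (∑ a, σ a x).trace = 1 := by
    fin_cases x
    · exact htr
    · rw [hσ] at htr; exact htr
  have hb (a : Fin 2) : ∑ b, P a b x y = (σ a x).trace.re := by
    rw [← sum_expectation_eq_trace (he.1 y), Complex.re_sum]
    exact Finset.sum_congr rfl fun b _ => h a b x y
  simp only [hb, ← Complex.re_sum, ← Matrix.trace_sum, hx, Complex.one_re]

lemma Unsteerable.nonneg {e : Fin 2 → Fin 2 → Vec} {P : Fin 2 → Fin 2 → Fin 2 → Fin 2 → ℝ}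
    (hP : Unsteerable e P) (a b x y : Fin 2) : 0 ≤ P a b x y := by
  obtain ⟨n, p, q, ρ, hp, -, hq, -, hρ, -, h⟩ := hP
  rw [h]
  exact Finset.sum_nonneg fun l _ =>
    mul_nonneg (mul_nonneg (hp l) (hq a x l)) ((hρ l).re_dotProduct_nonneg (e y b))

/-- A state orthogonal to an element of the first basis is unbiased in the second basis. -/
lemma IsMUBPair.expectation_eq_of_expectation_eq_zero {e : Fin 2 → Fin 2 → Vec}
    (he : IsMUBPair e) {ρ : Mat} (hρ : ρ.PosSemidef) {i : Fin 2}
    (hi : (star (e 0 i) ⬝ᵥ ρ *ᵥ e 0 i).re = 0) (b c : Fin 2) :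
    (star (e 1 b) ⬝ᵥ ρ *ᵥ e 1 b).re = (star (e 1 c) ⬝ᵥ ρ *ᵥ e 1 c).re := by
  have hker : ρ *ᵥ e 0 i = 0 := by
    rw [← hρ.dotProduct_mulVec_zero_iff]
    exact Complex.ext hi (Complex.nonneg_iff.mp (hρ.dotProduct_mulVec_nonneg (e 0 i))).2.symm
  have hker' : star (e 0 i) ᵥ* ρ = 0 := by
    have h := congrArg star hker
    rwa [Matrix.star_mulVec, hρ.1.eq, star_zero] at h
  have key (b : Fin 2) : (star (e 1 b) ⬝ᵥ ρ *ᵥ e 1 b).re =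
      1 / 2 * (star (e 0 (i + 1)) ⬝ᵥ ρ *ᵥ e 0 (i + 1)).re := by
    have hsum : e 1 b = inn (e 0 i) (e 1 b) • e 0 i +
        inn (e 0 (i + 1)) (e 1 b) • e 0 (i + 1) := by
      conv_lhs => rw [sum_inn_smul (he.1 0) (e 1 b)]
      fin_cases i
      · simp [Fin.sum_univ_two]
      · simp [Fin.sum_univ_two, add_comm]
    have hc := he.2 (i + 1) b
    generalize inn (e 0 i) (e 1 b) = c at hsum
    generalize inn (e 0 (i + 1)) (e 1 b) = d at hsum hc
    rw [hsum, Matrix.mulVec_add, Matrix.mulVec_smul, Matrix.mulVec_smul, hker, smul_zero, zero_add,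
      dotProduct_smul, Matrix.dotProduct_mulVec, star_add, Matrix.add_vecMul, star_smul, star_smul,
      Matrix.smul_vecMul, Matrix.smul_vecMul, hker', smul_zero, zero_add, smul_dotProduct,
      ← Matrix.dotProduct_mulVec, smul_smul, smul_eq_mul, Complex.star_def, Complex.mul_conj,
      Complex.re_ofReal_mul, hc]
  rw [key b, key c]

/-- An unsteerable box perfectly correlated on the inputs `(0, 0)` is uncorrelated on `(1, 1)`. -/
lemma Unsteerable.correlation_eq_zero {e : Fin 2 → Fin 2 → Vec} (he : IsMUBPair e)
    {P : Fin 2 → Fin 2 → Fin 2 → Fin 2 → ℝ} (hP : Unsteerable e P)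
    (h01 : P 0 1 0 0 = 0) (h10 : P 1 0 0 0 = 0) :
    P 0 0 1 1 + P 1 1 1 1 = P 0 1 1 1 + P 1 0 1 1 := by
  obtain ⟨n, p, q, ρ, hp, -, hq, hq1, hρ, -, h⟩ := hP
  have hterm (a b : Fin 2) (hab : P a b 0 0 = 0) (l : Fin n) :
      p l * q a 0 l * (star (e 0 b) ⬝ᵥ ρ l *ᵥ e 0 b).re = 0 := by
    rw [h] at hab
    exact (Finset.sum_eq_zero_iff_of_nonneg fun l _ => mul_nonneg (mul_nonneg (hp l) (hq a 0 l))
      ((hρ l).re_dotProduct_nonneg (e 0 b))).mp hab l (Finset.mem_univ l)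
  simp only [h, ← Finset.sum_add_distrib]
  refine Finset.sum_congr rfl fun l _ => ?_
  have hl0 := hterm 0 1 h01 l
  have hl1 := hterm 1 0 h10 l
  rcases eq_or_ne (p l) 0 with hpl | hpl
  · simp [hpl]
  have heq : (star (e 1 0) ⬝ᵥ ρ l *ᵥ e 1 0).re = (star (e 1 1) ⬝ᵥ ρ l *ᵥ e 1 1).re := by
    rcases eq_or_ne (q 0 0 l) 0 with hq0 | hq0
    · have hs := hq1 0 l
      rw [Fin.sum_univ_two, hq0, zero_add] at hs
      rw [hs, mul_one] at hl1
      exact he.expectation_eq_of_expectation_eq_zero (hρ l)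
        ((mul_eq_zero.mp hl1).resolve_left hpl) 0 1
    · exact he.expectation_eq_of_expectation_eq_zero (hρ l)
        ((mul_eq_zero.mp hl0).resolve_left (mul_ne_zero hpl hq0)) 0 1
  rw [heq]

/-- Every decomposition of the colored-noise BB84 box has steerable weight at least `V`. -/
lemma le_weight_of_Pcol_decomposition {e : Fin 2 → Fin 2 → Vec} (he : IsMUBPair e) {V p : ℝ}
    (h1 : V ≤ 1) (hp0 : 0 ≤ p) (hp1 : p ≤ 1) {PS PUS : Fin 2 → Fin 2 → Fin 2 → Fin 2 → ℝ}
    (hS : QuantumBox e PS) (hUS : Unsteerable e PUS)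
    (h : ∀ a b x y, Pcol V a b x y = p * PS a b x y + (1 - p) * PUS a b x y) : V ≤ p := by
  rcases hp1.eq_or_lt with rfl | hlt
  · exact h1
  have hzero (a b : Fin 2) (hab : Pcol V a b 0 0 = 0) : PUS a b 0 0 = 0 := by
    have hS' := mul_nonneg hp0 (hS.nonneg a b 0 0)
    have hUS' := hUS.nonneg a b 0 0
    have := h a b 0 0
    nlinarith
  have hcorr := hUS.correlation_eq_zero he
    (hzero 0 1 (by norm_num [Pcol, fin_two_one_add_one]; ring)) (hzero 1 0 (by norm_num [Pcol, fin_two_one_add_one]; ring))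
  have hsum := hS.sum_eq_one he 1 1
  simp only [Fin.sum_univ_two] at hsum
  have hV : V = p * (PS 0 1 1 1 + PS 1 0 1 1 - PS 0 0 1 1 - PS 1 1 1 1) := by
    have h00 := h 0 0 1 1
    have h01 := h 0 1 1 1
    have h10 := h 1 0 1 1
    have h11 := h 1 1 1 1
    simp only [Pcol, fin_two_one_add_one] at h00 h01 h10 h11
    norm_num [fin_two_one_add_one] at h00 h01 h10 h11
    linear_combination h01 + h10 - h00 - h11 - (1 - p) * hcorr
  rw [hV]
  refine mul_le_of_le_one_right hp0 ?_
  linarith [hS.nonneg 0 0 1 1, hS.nonneg 1 1 1 1]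

/-- The steering cost of the colored-noise BB84 family: `C(P_col^V) = V`. -/
theorem colored_bb84_steering_cost (e : Fin 2 → Fin 2 → Vec) (he : IsMUBPair e)
    (V : ℝ) (h0 : 0 ≤ V) (h1 : V ≤ 1) :
    steeringCost e (Pcol V) = V := by
  exact IsLeast.csInf_eq ⟨⟨⟨h0, h1⟩, Pcol 1, Pcol 0, quantumBox_Pcol_one he,
    unsteerable_Pcol_zero he, Pcol_eq_mix V⟩, fun _ ⟨⟨hp0, hp1⟩, _, _, hS, hUS, h⟩ =>
    le_weight_of_Pcol_decomposition he h1 hp0 hp1 hS hUS h⟩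
end
end

section
/- Fix a MUB pair on the qubit. Let {σ_{a|x}}, {σ′_{a|x}}, {σ″_{a|x}} be assemblages with σ_{a|x} = μ·σ′_{a|x} + (1−μ)·σ″_{a|x} for all a,x, where 0 ≤ μ ≤ 1. Then the steering cost of the associated boxes satisfies C(P[σ]) ≤ μ·C(P[σ′]) + (1−μ)·C(P[σ″]), where P[σ](a,b|x,y) = ⟨e^y_b, σ_{a|x} e^y_b⟩. In other words, the steering cost is convex. -/
open Matrix Complex BigOperators
open scoped ComplexOrder

noncomputable section

/-- Boxes, with the pointwise linear structure. -/
abbrev Box : Type := Fin 2 → Fin 2 → Fin 2 → Fin 2 → ℝ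

lemma boxOf_add_smul (e : Fin 2 → Fin 2 → Vec) (σ τ : Fin 2 → Fin 2 → Mat) (s t : ℝ) :
    boxOf e (fun a x => (s : ℂ) • σ a x + (t : ℂ) • τ a x) = s • boxOf e σ + t • boxOf e τ := by
  funext a b x y
  simp only [boxOf, Matrix.add_mulVec, Matrix.smul_mulVec, dotProduct_add, dotProduct_smul,
    smul_eq_mul, Complex.add_re, Complex.re_ofReal_mul, Pi.add_apply, Pi.smul_apply]

lemma IsAssemblage.add_smul {σ τ : Fin 2 → Fin 2 → Mat} (hσ : IsAssemblage σ)
    (hτ : IsAssemblage τ) {s t : ℝ} (hs : 0 ≤ s) (ht : 0 ≤ t) (hst : s + t = 1) :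
    IsAssemblage (fun a x => (s : ℂ) • σ a x + (t : ℂ) • τ a x) := by
  obtain ⟨hσ0, hσs, hσt⟩ := hσ
  obtain ⟨hτ0, hτs, hτt⟩ := hτ
  refine ⟨fun a x => ((hσ0 a x).smul (by exact_mod_cast hs)).add
    ((hτ0 a x).smul (by exact_mod_cast ht)), ?_, ?_⟩
  · simp only [Finset.sum_add_distrib, ← Finset.smul_sum, hσs, hτs]
  · simp only [Finset.sum_add_distrib, ← Finset.smul_sum, Matrix.trace_add, Matrix.trace_smul,
      hσt, hτt, smul_eq_mul, mul_one]
    exact_mod_cast hst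

lemma convex_quantumBox (e : Fin 2 → Fin 2 → Vec) : Convex ℝ {P : Box | QuantumBox e P} := by
  rintro P ⟨σ, hσ, hP⟩ Q ⟨τ, hτ, hQ⟩ s t hs ht hst
  refine ⟨_, hσ.add_smul hτ hs ht hst, fun a b x y => ?_⟩
  rw [boxOf_add_smul]
  simp [hP, hQ]

lemma convex_unsteerable (e : Fin 2 → Fin 2 → Vec) : Convex ℝ {P : Box | Unsteerable e P} := by
  rintro P ⟨n, p, q, ρ, hp, hp1, hq, hq1, hρ, hρ1, hP⟩
    Q ⟨m, p', q', ρ', hp', hp1', hq', hq1', hρ', hρ1', hQ⟩ s t hs ht hst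
  refine ⟨n + m, Fin.append (fun l => s * p l) (fun l => t * p' l),
    fun a x => Fin.append (q a x) (q' a x), Fin.append ρ ρ', ?_, ?_, ?_, ?_, ?_, ?_, ?_⟩
  · exact Fin.addCases (fun l => by simpa using mul_nonneg hs (hp l))
      (fun l => by simpa using mul_nonneg ht (hp' l))
  · simp [Fin.sum_univ_add, ← Finset.mul_sum, hp1, hp1', hst]
  · exact fun a x => Fin.addCases (fun l => by simpa using hq a x l)
      (fun l => by simpa using hq' a x l)
  · exact fun x => Fin.addCases (fun l => by simpa using hq1 x l)
      (fun l => by simpa using hq1' x l)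
  · exact Fin.addCases (fun l => by simpa using hρ l) (fun l => by simpa using hρ' l)
  · exact Fin.addCases (fun l => by simpa using hρ1 l) (fun l => by simpa using hρ1' l)
  · intro a b x y
    simp [Fin.sum_univ_add, hP, hQ, Finset.mul_sum, mul_assoc]

lemma exists_unsteerable (e : Fin 2 → Fin 2 → Vec) : ∃ P : Box, Unsteerable e P := by
  refine ⟨_, 1, fun _ => 1, fun _ _ _ => 1 / 2, fun _ => (1 / 2 : ℂ) • (1 : Mat), ?_, ?_, ?_, ?_,
    ?_, ?_, fun _ _ _ _ => rfl⟩
  · simp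
  · simp
  · intros; norm_num
  · intros; norm_num
  · exact fun _ => Matrix.PosSemidef.one.smul (by positivity)
  · simp [Matrix.trace_smul]

/-- In a convex set, a nonnegative combination of two points is a multiple of a single point. -/
lemma Convex.exists_add_smul_eq {E : Type*} [AddCommGroup E] [Module ℝ E] {K : Set E}
    (hK : Convex ℝ K) {x y : E} (hx : x ∈ K) (hy : y ∈ K) {s t : ℝ} (hs : 0 ≤ s) (ht : 0 ≤ t) :
    ∃ z ∈ K, (s + t) • z = s • x + t • y := by
  open scoped Pointwise in
  have h : s • x + t • y ∈ (s + t) • K := by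
    rw [hK.add_smul hs ht]
    exact Set.add_mem_add (Set.smul_mem_smul_set hx) (Set.smul_mem_smul_set hy)
  exact Set.mem_smul_set.mp h

/-- The weights of the steerable part over all decompositions of a box. -/
def steerableWeights (e : Fin 2 → Fin 2 → Vec) (P : Box) : Set ℝ :=
  {p : ℝ | p ∈ Set.Icc (0 : ℝ) 1 ∧ ∃ PS PUS : Box, QuantumBox e PS ∧ Unsteerable e PUS ∧
    ∀ a b x y, P a b x y = p * PS a b x y + (1 - p) * PUS a b x y}

lemma steerableWeights_nonempty {e : Fin 2 → Fin 2 → Vec} {P : Box} (hP : QuantumBox e P) :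
    (steerableWeights e P).Nonempty := by
  obtain ⟨U, hU⟩ := exists_unsteerable e
  exact ⟨1, by simp, P, U, hP, hU, by simp⟩

lemma add_mem_steerableWeights {e : Fin 2 → Fin 2 → Vec} {P Q : Box} {p q s t : ℝ}
    (hp : p ∈ steerableWeights e P) (hq : q ∈ steerableWeights e Q)
    (hs : 0 ≤ s) (ht : 0 ≤ t) (hst : s + t = 1) :
    s * p + t * q ∈ steerableWeights e (s • P + t • Q) := by
  obtain ⟨hp01, PS, PU, hPS, hPU, hP⟩ := hp
  obtain ⟨hq01, QS, QU, hQS, hQU, hQ⟩ := hq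
  obtain ⟨S, hS, hSeq⟩ := (convex_quantumBox e).exists_add_smul_eq hPS hQS
    (mul_nonneg hs hp01.1) (mul_nonneg ht hq01.1)
  obtain ⟨U, hU, hUeq⟩ := (convex_unsteerable e).exists_add_smul_eq hPU hQU
    (mul_nonneg hs (sub_nonneg.2 hp01.2)) (mul_nonneg ht (sub_nonneg.2 hq01.2))
  refine ⟨convex_Icc (0 : ℝ) 1 hp01 hq01 hs ht hst, S, U, hS, hU, fun a b x y => ?_⟩
  have h₁ := congrFun (congrFun (congrFun (congrFun hSeq a) b) x) y
  have h₂ := congrFun (congrFun (congrFun (congrFun hUeq a) b) x) y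
  simp only [Pi.add_apply, Pi.smul_apply, smul_eq_mul] at h₁ h₂ ⊢
  rw [hP, hQ]
  linear_combination -h₁ - h₂ + U a b x y * hst

/-- Convexity of the steering cost: if `σ = μ·σ′ + (1−μ)·σ″` as assemblages, then
`C(P[σ]) ≤ μ·C(P[σ′]) + (1−μ)·C(P[σ″])`. -/
theorem steeringCost_convex (e : Fin 2 → Fin 2 → Vec) (he : IsMUBPair e)
    (σ σ' σ'' : Fin 2 → Fin 2 → Mat)
    (hσ : IsAssemblage σ) (hσ' : IsAssemblage σ') (hσ'' : IsAssemblage σ'')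
    (μ : ℝ) (hμ0 : 0 ≤ μ) (hμ1 : μ ≤ 1)
    (hmix : ∀ a x, σ a x = (μ : ℂ) • σ' a x + ((1 - μ : ℝ) : ℂ) • σ'' a x) :
    steeringCost e (boxOf e σ) ≤
      μ * steeringCost e (boxOf e σ') + (1 - μ) * steeringCost e (boxOf e σ'') := by
  have hbox : boxOf e σ = μ • boxOf e σ' + (1 - μ) • boxOf e σ'' := by
    rw [← boxOf_add_smul]
    exact congrArg (boxOf e) (funext fun a => funext (hmix a))
  refine le_of_forall_pos_le_add fun ε hε => ?_
  obtain ⟨p, hp, hpε⟩ := Real.lt_sInf_add_pos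
    (steerableWeights_nonempty ⟨σ', hσ', fun _ _ _ _ => rfl⟩ :
      (steerableWeights e (boxOf e σ')).Nonempty) hε
  obtain ⟨q, hq, hqε⟩ := Real.lt_sInf_add_pos
    (steerableWeights_nonempty ⟨σ'', hσ'', fun _ _ _ _ => rfl⟩ :
      (steerableWeights e (boxOf e σ'')).Nonempty) hε
  change p < steeringCost e (boxOf e σ') + ε at hpε
  change q < steeringCost e (boxOf e σ'') + ε at hqε
  have hle : steeringCost e (boxOf e σ) ≤ μ * p + (1 - μ) * q :=
    csInf_le ⟨0, fun _ h => h.1.1⟩ (hbox ▸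
      add_mem_steerableWeights hp hq hμ0 (sub_nonneg.2 hμ1) (add_sub_cancel μ 1))
  linarith [mul_le_mul_of_nonneg_left hpε.le hμ0,
    mul_le_mul_of_nonneg_left hqε.le (sub_nonneg.2 hμ1)]
end
end

section
/- For every 0 ≤ V ≤ 1, the BB84 family box admits a local hidden variable model using shared randomness of dimension 4 with deterministic strategies on Alice's side: there exist probability distributions P_λ(·|y) on {0,1} (λ ∈ {1,2,3,4}, y ∈ {0,1}) such that P_BB84^V(a,b|x,y) = (1/4)·Σ_{λ=1}^{4} D_λ(a|x)·P_λ(b|y) for all a,b,x,y, where D₁,D₂,D₃,D₄ are the four single-party deterministic boxes D(a|x) = 1[a = α·x ⊕ β] for (α,β) ∈ {0,1}². -/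
open Matrix Complex BigOperators
open scoped ComplexOrder

noncomputable section

/-- The BB84 family admits a dimension-4 LHV model with deterministic strategies on
Alice's side. -/
theorem bb84_LHV_dim4 (V : ℝ) (h0 : 0 ≤ V) (h1 : V ≤ 1) :
    ∃ Q : Fin 2 → Fin 2 → Fin 2 × Fin 2 → ℝ,
      (∀ b y l, 0 ≤ Q b y l) ∧ (∀ y l, ∑ b, Q b y l = 1) ∧
      ∀ a b x y, PBB84 V a b x y =
        (1 / 4) * ∑ l : Fin 2 × Fin 2,
          (if a = l.1 * x + l.2 then 1 else 0) * Q b y l := by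
  have hpow (n : ℕ) : (-1 : ℝ) ^ n = 1 ∨ (-1 : ℝ) ^ n = -1 := neg_one_pow_eq_or ℝ n
  refine ⟨fun b y l => (1 + (-1 : ℝ) ^ ((l.1 * y + l.2 + b + y : Fin 2) : ℕ) * V) / 2,
    fun b y l => ?_, fun y l => ?_, fun a b x y => ?_⟩
  · rcases hpow ((l.1 * y + l.2 + b + y : Fin 2) : ℕ) with h | h <;> simp only [h] <;> linarith
  · obtain ⟨α, β⟩ := l
    fin_cases y <;> fin_cases α <;> fin_cases β <;> simp [Fin.sum_univ_two] <;> ring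
  · fin_cases a <;> fin_cases b <;> fin_cases x <;> fin_cases y <;>
      simp [PBB84, Fintype.sum_prod_type, Fin.sum_univ_two] <;> ring
end
end

section
/- For every 0 ≤ V ≤ 1, the analogous CHSH steering functional of the BB84 family box equals S(P_BB84^V) = 2√2·V; consequently P_BB84^V violates the analogous CHSH steering inequality S(P) ≤ 2 if and only if V > 1/√2. -/
open Matrix Complex BigOperators
open scoped ComplexOrder

noncomputable section

/-- Correlator `⟨A_x B_y⟩ = Σ_{a,b} (−1)^{a⊕b} P(a,b|x,y)`. -/
def corr (P : Fin 2 → Fin 2 → Fin 2 → Fin 2 → ℝ) (x y : Fin 2) : ℝ :=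
  ∑ a, ∑ b, (-1 : ℝ) ^ ((a + b : Fin 2) : ℕ) * P a b x y

/-- The analogous CHSH steering functional. -/
def SFunc (P : Fin 2 → Fin 2 → Fin 2 → Fin 2 → ℝ) : ℝ :=
  Real.sqrt ((corr P 0 0 + corr P 1 0) ^ 2 + (corr P 0 1 + corr P 1 1) ^ 2) +
  Real.sqrt ((corr P 0 0 - corr P 1 0) ^ 2 + (corr P 0 1 - corr P 1 1) ^ 2)

theorem corr_PBB84 (V : ℝ) (x y : Fin 2) :
    corr (PBB84 V) x y = (-1 : ℝ) ^ ((x * y : Fin 2) : ℕ) * (if x = y then V else 0) := by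
  have h : (1 + 1 : Fin 2) = 0 := rfl
  fin_cases x <;> fin_cases y <;> norm_num [corr, PBB84, Fin.sum_univ_two, h] <;> ring

theorem SFunc_PBB84 {V : ℝ} (h0 : 0 ≤ V) : SFunc (PBB84 V) = 2 * Real.sqrt 2 * V := by
  have h : Real.sqrt (V ^ 2 + V ^ 2) = Real.sqrt 2 * V := by
    rw [← two_mul, Real.sqrt_mul zero_le_two, Real.sqrt_sq h0]
  simp only [SFunc, corr_PBB84]
  norm_num [h]
  ring

/-- `S(P_BB84^V) = 2√2·V`; the steering inequality `S ≤ 2` is violated iff `V > 1/√2`. -/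
theorem bb84_steering_functional (V : ℝ) (h0 : 0 ≤ V) (h1 : V ≤ 1) :
    SFunc (PBB84 V) = 2 * Real.sqrt 2 * V ∧
    (2 < SFunc (PBB84 V) ↔ 1 / Real.sqrt 2 < V) := by
  have hS := SFunc_PBB84 h0
  refine ⟨hS, ?_⟩
  rw [hS, div_lt_iff₀ (Real.sqrt_pos.mpr zero_lt_two)]
  constructor <;> intro h <;> linarith
end
end

section
/- Let 0 ≤ V ≤ 1 and let ρ_col = V·|Ψ⁻⟩⟨Ψ⁻| + (1−V)·(|01⟩⟨01| + |10⟩⟨10|)/2 be the colored-noise two-qubit maximally entangled state, where |Ψ⁻⟩ = (|01⟩ − |10⟩)/√2. With the projectors Π^A_{a|0} = (I − (−1)^a σ_z)/2, Π^A_{a|1} = (I + (−1)^a σ_x)/2 for Alice and Π^B_{b|0} = (I + (−1)^b σ_z)/2, Π^B_{b|1} = (I + (−1)^b σ_x)/2 for Bob (a,b ∈ {0,1}), one has Tr[(Π^A_{a|x} ⊗ Π^B_{b|y}) ρ_col] = P_col^V(a,b|x,y) for all a,b,x,y ∈ {0,1}. -/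
open Matrix Complex BigOperators
open scoped ComplexOrder

noncomputable section

abbrev Mat4 : Type := Matrix (Fin 2 × Fin 2) (Fin 2 × Fin 2) ℂ

open Kronecker

/-- Pauli σ_z. -/
def sz : Mat := !![1, 0; 0, -1]

/-- Pauli σ_x. -/
def sx : Mat := !![0, 1; 1, 0]

/-- Alice's projectors: Π^A_{a|0} = (I − (−1)^a σ_z)/2, Π^A_{a|1} = (I + (−1)^a σ_x)/2. -/
def PiA (a x : Fin 2) : Mat :=
  if x = 0 then (1 / 2 : ℂ) • ((1 : Mat) - ((-1 : ℂ)) ^ (a : ℕ) • sz)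
  else (1 / 2 : ℂ) • ((1 : Mat) + ((-1 : ℂ)) ^ (a : ℕ) • sx)

/-- Bob's projectors: Π^B_{b|0} = (I + (−1)^b σ_z)/2, Π^B_{b|1} = (I + (−1)^b σ_x)/2. -/
def PiB (b y : Fin 2) : Mat :=
  if y = 0 then (1 / 2 : ℂ) • ((1 : Mat) + ((-1 : ℂ)) ^ (b : ℕ) • sz)
  else (1 / 2 : ℂ) • ((1 : Mat) + ((-1 : ℂ)) ^ (b : ℕ) • sx)

/-- The singlet vector |Ψ⁻⟩ = (|01⟩ − |10⟩)/√2. -/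
def PsiMinus : Fin 2 × Fin 2 → ℂ :=
  fun p => if p = (0, 1) then ((1 / Real.sqrt 2 : ℝ) : ℂ)
           else if p = (1, 0) then (-(1 / Real.sqrt 2 : ℝ) : ℂ) else 0

/-- The projector |Ψ⁻⟩⟨Ψ⁻|. -/
def projPsiMinus : Mat4 := Matrix.vecMulVec PsiMinus (star PsiMinus)

/-- Basis vector |01⟩. -/
def e01 : Fin 2 × Fin 2 → ℂ := fun p => if p = (0, 1) then 1 else 0

/-- Basis vector |10⟩. -/
def e10 : Fin 2 × Fin 2 → ℂ := fun p => if p = (1, 0) then 1 else 0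

/-- The colored-noise state `ρ_col = V|Ψ⁻⟩⟨Ψ⁻| + (1−V)(|01⟩⟨01| + |10⟩⟨10|)/2`. -/
def rhoCol (V : ℝ) : Mat4 :=
  (V : ℂ) • projPsiMinus +
    (((1 - V) / 2 : ℝ) : ℂ) •
      (Matrix.vecMulVec e01 (star e01) + Matrix.vecMulVec e10 (star e10))

/-- The expectation of a product operator in the state `rhoCol V`. -/
theorem trace_kronecker_mul_rhoCol (V : ℝ) (A B : Mat) :
    ((A ⊗ₖ B) * rhoCol V).trace =
      (A 0 0 * B 1 1 + A 1 1 * B 0 0) / 2 - V / 2 * (A 0 1 * B 1 0 + A 1 0 * B 0 1) := by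
  have h : ((Real.sqrt 2 : ℝ) : ℂ)⁻¹ * ((Real.sqrt 2 : ℝ) : ℂ)⁻¹ = 1 / 2 := by
    rw [← mul_inv, ← Complex.ofReal_mul, Real.mul_self_sqrt (by norm_num)]
    norm_num
  simp [Matrix.trace, Matrix.mul_apply, Fintype.sum_prod_type, Fin.sum_univ_two, rhoCol,
    projPsiMinus, PsiMinus, e01, e10, Matrix.vecMulVec_apply, Matrix.kroneckerMap_apply, h]
  ring

/-- The colored-noise state with the stated measurements produces the colored-noise
BB84 family box. -/
theorem colored_state_gives_colored_bb84 (V : ℝ) (h0 : 0 ≤ V) (h1 : V ≤ 1)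
    (a b x y : Fin 2) :
    ((PiA a x ⊗ₖ PiB b y) * rhoCol V).trace = (Pcol V a b x y : ℂ) := by
  rw [trace_kronecker_mul_rhoCol]
  fin_cases x <;> fin_cases y <;> fin_cases a <;> fin_cases b <;>
    simp [PiA, PiB, sz, sx, Pcol] <;> ring
end
end

section
/- For every 0 ≤ V ≤ 1, the colored-noise BB84 family box admits a local hidden variable model using shared randomness of dimension 4 with deterministic strategies on Alice's side: there exist probability distributions P_λ(·|y) on {0,1} (λ ∈ {1,2,3,4}, y ∈ {0,1}) such that P_col^V(a,b|x,y) = (1/4)·Σ_{λ=1}^{4} D_λ(a|x)·P_λ(b|y) for all a,b,x,y, where D₁,D₂,D₃,D₄ are the four single-party deterministic boxes D(a|x) = 1[a = α·x ⊕ β] for (α,β) ∈ {0,1}². -/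
open Matrix Complex BigOperators
open scoped ComplexOrder

noncomputable section

/-- The colored-noise BB84 family admits a dimension-4 LHV model with deterministic
strategies on Alice's side. -/
theorem colored_bb84_LHV_dim4 (V : ℝ) (h0 : 0 ≤ V) (h1 : V ≤ 1) :
    ∃ Q : Fin 2 → Fin 2 → Fin 2 × Fin 2 → ℝ,
      (∀ b y l, 0 ≤ Q b y l) ∧ (∀ y l, ∑ b, Q b y l = 1) ∧
      ∀ a b x y, Pcol V a b x y =
        (1 / 4) * ∑ l : Fin 2 × Fin 2,
          (if a = l.1 * x + l.2 then 1 else 0) * Q b y l := by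
  refine ⟨fun b y l => (1 + (-1 : ℝ) ^ (b + l.2 : ℕ) *
    (if y = 0 then 1 else -V * (-1 : ℝ) ^ (l.1 : ℕ))) / 2, ?_, ?_, ?_⟩
  · rintro b y ⟨α, β⟩
    fin_cases b <;> fin_cases y <;> fin_cases α <;> fin_cases β <;> norm_num <;> linarith
  · rintro y ⟨α, β⟩
    simp only [Fin.sum_univ_two, Fin.val_zero, Fin.val_one, pow_add]
    ring
  · have two_eq_zero : (1 + 1 : Fin 2) = 0 := rfl
    intro a b x y
    simp only [Fintype.sum_prod_type, Fin.sum_univ_two, Pcol]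
    fin_cases a <;> fin_cases b <;> fin_cases x <;> fin_cases y <;>
      simp [two_eq_zero] <;> ring
end
end
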